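/- For the inhomogeneous multinomial measure $\mu$ on the ultrametric space $(\partial\mathscr{A}_{1,2}^\ast,d)$ (whose support is the whole space), for every $q\in\mathbb{R}$ one has $B_\mu(q)=\tau_\mu(q)=\max\{\theta_a(q),\theta_b(q)\}$ and $b_\mu(q)=\min\{\theta_a(q),\theta_b(q)\}$, where $b_\mu$, $B_\mu$, $\tau_\mu$ are Olsen's functions of $\mu$. -/

import Mathlib

open MeasureTheory Metric Set Filter Topology Classical
open scoped ENNReal NNReal

noncomputable section

namespace MF

/-! ### Olsen's multifractal measures and dimension functions on a metric space -/

variable {X : Type} [MetricSpace X]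

/-- The sum `∑ m(B(xᵢ,rᵢ))^q (2rᵢ)^t` associated with a countable family of centered balls. -/
def olsenSum [MeasurableSpace X] (m : Measure X) (q t : ℝ) {ι : Type}
    (c : ι → X) (r : ι → ℝ) : ℝ≥0∞ :=
  ∑' i, m (closedBall (c i) (r i)) ^ q * ENNReal.ofReal (2 * r i) ^ t

/-- `Olsen's 𝓗^{q,t}_{m,δ}`: infimum over countable centered `δ`-coverings of `E`. -/
def Hdel [MeasurableSpace X] (m : Measure X) (q t δ : ℝ) (E : Set X) : ℝ≥0∞ :=
  ⨅ (ι : Type) (_ : Countable ι) (c : ι → X) (r : ι → ℝ)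
    (_ : ∀ i, c i ∈ E) (_ : ∀ i, 0 < r i ∧ r i ≤ δ)
    (_ : E ⊆ ⋃ i, closedBall (c i) (r i)), olsenSum m q t c r

/-- Olsen's premeasure `𝓗̄^{q,t}_m` (limit, i.e. supremum, as `δ ↓ 0`). -/
def Hpre [MeasurableSpace X] (m : Measure X) (q t : ℝ) (E : Set X) : ℝ≥0∞ :=
  ⨆ (δ : ℝ) (_ : 0 < δ), Hdel m q t δ E

/-- Olsen's multifractal Hausdorff measure `𝓗^{q,t}_m`. -/
def Hmeas [MeasurableSpace X] (m : Measure X) (q t : ℝ) (E : Set X) : ℝ≥0∞ :=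
  ⨆ (F : Set X) (_ : F ⊆ E), Hpre m q t F

/-- `𝓟̄^{q,t}_{m,δ}`: supremum over countable centered `δ`-packings of `E`. -/
def Pdel [MeasurableSpace X] (m : Measure X) (q t δ : ℝ) (E : Set X) : ℝ≥0∞ :=
  ⨆ (ι : Type) (_ : Countable ι) (c : ι → X) (r : ι → ℝ)
    (_ : ∀ i, c i ∈ E) (_ : ∀ i, 0 < r i ∧ r i ≤ δ)
    (_ : ∀ i j, i ≠ j → Disjoint (closedBall (c i) (r i)) (closedBall (c j) (r j))),
    olsenSum m q t c r

/-- Olsen's packing premeasure `𝓟̄^{q,t}_m` (limit, i.e. infimum, as `δ ↓ 0`). -/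
def Ppre [MeasurableSpace X] (m : Measure X) (q t : ℝ) (E : Set X) : ℝ≥0∞ :=
  ⨅ (δ : ℝ) (_ : 0 < δ), Pdel m q t δ E

/-- Olsen's multifractal packing measure `𝓟^{q,t}_m`. -/
def Pmeas [MeasurableSpace X] (m : Measure X) (q t : ℝ) (E : Set X) : ℝ≥0∞ :=
  ⨅ (En : ℕ → Set X) (_ : E ⊆ ⋃ n, En n), ∑' n, Ppre m q t (En n)

/-- The (topological) support of a measure on a metric space. -/
def msupport [MeasurableSpace X] (m : Measure X) : Set X :=
  {x | ∀ r : ℝ, 0 < r → 0 < m (ball x r)}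

/-- Olsen's multifractal Hausdorff dimension function `b_m`. -/
def bFun [MeasurableSpace X] (m : Measure X) (q : ℝ) : ℝ :=
  sInf {t | Hmeas m q t (msupport m) = 0}

/-- Olsen's multifractal packing dimension function `B_m`. -/
def BFun [MeasurableSpace X] (m : Measure X) (q : ℝ) : ℝ :=
  sInf {t | Pmeas m q t (msupport m) = 0}

/-- Olsen's function `τ_m`. -/
def tauFun [MeasurableSpace X] (m : Measure X) (q : ℝ) : ℝ :=
  sInf {t | Ppre m q t (msupport m) = 0}

/-- `t`-dimensional packing pre-premeasure at scale `δ`. -/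
def pPdel (t δ : ℝ) (E : Set X) : ℝ≥0∞ :=
  ⨆ (ι : Type) (_ : Countable ι) (c : ι → X) (r : ι → ℝ)
    (_ : ∀ i, c i ∈ E) (_ : ∀ i, 0 < r i ∧ r i ≤ δ)
    (_ : ∀ i j, i ≠ j → Disjoint (closedBall (c i) (r i)) (closedBall (c j) (r j))),
    ∑' i, ENNReal.ofReal (2 * r i) ^ t

/-- `t`-dimensional packing premeasure. -/
def pPpre (t : ℝ) (E : Set X) : ℝ≥0∞ := ⨅ (δ : ℝ) (_ : 0 < δ), pPdel t δ E

/-- `t`-dimensional packing measure. -/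
def pPmeas (t : ℝ) (E : Set X) : ℝ≥0∞ :=
  ⨅ (En : ℕ → Set X) (_ : E ⊆ ⋃ n, En n), ∑' n, pPpre t (En n)

/-- Packing dimension of a set. -/
def packDim (E : Set X) : ℝ := sInf {t | pPmeas t E = 0}

/-- The level set `X_m(α)` of points of the support where the local Hölder exponent is `α`. -/
def Xlev [MeasurableSpace X] (m : Measure X) (α : ℝ) : Set X :=
  {x | x ∈ msupport m ∧
    Tendsto (fun r => Real.log (m (closedBall x r)).toReal / Real.log r)
      (𝓝[>] (0 : ℝ)) (𝓝 α)}

/-- Legendre transform `f^*(x) = inf_y (xy + f(y))`. -/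
def leg (f : ℝ → ℝ) (x : ℝ) : ℝ := ⨅ y : ℝ, (x * y + f y)

/-! ### The mixed symbolic space and inhomogeneous multinomial measures -/

/-- `j` is an index governed by the first alphabet:
`T (2k-1) ≤ j < T (2k)` for some `k ≥ 1`. -/
def isA (T : ℕ → ℕ) (j : ℕ) : Prop :=
  ∃ k, 1 ≤ k ∧ T (2 * k - 1) ≤ j ∧ j < T (2 * k)

/-- The size of the alphabet at (0-based) position `n`, i.e. at paper index `j = n+1`. -/
def Yc (c₁ c₂ : ℕ) (T : ℕ → ℕ) (n : ℕ) : ℕ := if isA T (n + 1) then c₁ else c₂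

/-- The mixed symbolic space `∂𝒜₁,₂* = ∏ⱼ Yⱼ`. -/
abbrev Omg (c₁ c₂ : ℕ) (T : ℕ → ℕ) : Type := ∀ n : ℕ, Fin (Yc c₁ c₂ T n)

/-- Finite words of length `n`. -/
abbrev Word (c₁ c₂ : ℕ) (T : ℕ → ℕ) (n : ℕ) : Type :=
  ∀ i : Fin n, Fin (Yc c₁ c₂ T i.val)

/-- `N_n`: the number of indices `1 ≤ j ≤ n` governed by the first alphabet. -/
def Ncount (T : ℕ → ℕ) (n : ℕ) : ℕ := ((Finset.Icc 1 n).filter (isA T)).card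

/-- Diameter `c₁^{-N_n} c₂^{-(n-N_n)}` of a cylinder of generation `n`. -/
def Dw (c₁ c₂ : ℕ) (T : ℕ → ℕ) (n : ℕ) : ℝ :=
  ((c₁ : ℝ) ^ Ncount T n * (c₂ : ℝ) ^ (n - Ncount T n))⁻¹

/-- The cylinder `[w]` defined by a finite word `w`. -/
def cyl (c₁ c₂ : ℕ) (T : ℕ → ℕ) (n : ℕ) (w : Word c₁ c₂ T n) : Set (Omg c₁ c₂ T) :=
  {x | ∀ i : Fin n, x i.val = w i}

/-- The mass `∏_{j≤n} p_j` given to the cylinder `[w]` by the inhomogeneous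
multinomial measure with weights `a` and `b`. -/
def cylWeight (c₁ c₂ : ℕ) (T : ℕ → ℕ) (a b : ℕ → ℝ) (n : ℕ) (w : Word c₁ c₂ T n) : ℝ :=
  ∏ i : Fin n, (if isA T (i.val + 1) then a (w i).val else b (w i).val)

/-- `θ(q) = log_c (p₁^q + ⋯ + p_c^q)`. -/
def theta (c : ℕ) (p : ℕ → ℝ) (q : ℝ) : ℝ :=
  Real.logb c (∑ i ∈ Finset.range c, p i ^ q)

/-- `τ_{μ,n}(q)`, defined by `∑_{z ∈ 𝒜₁,₂ⁿ} μ([z])^q = |w|^{-τ_{μ,n}(q)}`. -/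
def tauN (c₁ c₂ : ℕ) (T : ℕ → ℕ) (a b : ℕ → ℝ) (q : ℝ) (n : ℕ) : ℝ :=
  Real.log (∑ z : Word c₁ c₂ T n, cylWeight c₁ c₂ T a b n z ^ q) /
    Real.log ((c₁ : ℝ) ^ Ncount T n * (c₂ : ℝ) ^ (n - Ncount T n))

/-- The natural projection `γ : ∂𝒜₁,₂* → [0,1]`,
`γ(ε₁ε₂⋯) = ∑_{n≥1} εₙ c₁^{-N_n} c₂^{-(n-N_n)}`. -/
def gammaMap (c₁ c₂ : ℕ) (T : ℕ → ℕ) (x : Omg c₁ c₂ T) : ℝ :=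
  ∑' n : ℕ, ((x n).val : ℝ) * Dw c₁ c₂ T (n + 1)

/-- The normalized weights `pᵢ^q / (p₁^q + ⋯ + p_c^q)`. -/
def taW (c : ℕ) (p : ℕ → ℝ) (q : ℝ) (i : ℕ) : ℝ :=
  p i ^ q / ∑ j ∈ Finset.range c, p j ^ q

/-- `s₁ = min{max aᵢ, max bⱼ}`. -/
def sOne (c₁ c₂ : ℕ) (a b : ℕ → ℝ) : ℝ :=
  min (sSup {x | ∃ i < c₁, a i = x}) (sSup {x | ∃ j < c₂, b j = x})

/-- `s₂ = max{min aᵢ, min bⱼ}`. -/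
def sTwo (c₁ c₂ : ℕ) (a b : ℕ → ℝ) : ℝ :=
  max (sInf {x | ∃ i < c₁, a i = x}) (sInf {x | ∃ j < c₂, b j = x})

/-- Entropy `h(p) = -∑_{i<2} pᵢ log₂ pᵢ`. -/
def hEnt (p : ℕ → ℝ) : ℝ := -(∑ i ∈ Finset.range 2, p i * Real.logb 2 (p i))

/-! ### Dyadic intervals -/

/-- The family `𝓕_n` of dyadic intervals of generation `n` in `[0,1]`. -/
def Fnfam (n : ℕ) : Set (Set ℝ) :=
  {I | ∃ j : ℕ, j < 2 ^ n ∧ I = Set.Icc ((j : ℝ) / 2 ^ n) (((j : ℝ) + 1) / 2 ^ n)}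

/-- Index of the dyadic interval of generation `n` containing `x`
(the left one when `x` is dyadic). -/
def dyadIdx (n : ℕ) (x : ℝ) : ℤ := ⌈x * 2 ^ n⌉ - 1

/-- `I_n(x)`: the dyadic interval of generation `n` containing `x`
(the left one when `x` is dyadic). -/
def Idyad (n : ℕ) (x : ℝ) : Set ℝ :=
  Set.Icc ((dyadIdx n x : ℝ) / 2 ^ n) (((dyadIdx n x : ℝ) + 1) / 2 ^ n)

/-- `I_n(x)⁺`: the right neighbour of `I_n(x)` in `𝓕_n`. -/
def IdyadP (n : ℕ) (x : ℝ) : Set ℝ :=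
  Set.Icc (((dyadIdx n x : ℝ) + 1) / 2 ^ n) (((dyadIdx n x : ℝ) + 2) / 2 ^ n)

/-- `I_n(x)⁻`: the left neighbour of `I_n(x)` in `𝓕_n`. -/
def IdyadM (n : ℕ) (x : ℝ) : Set ℝ :=
  Set.Icc (((dyadIdx n x : ℝ) - 1) / 2 ^ n) ((dyadIdx n x : ℝ) / 2 ^ n)

/-! ### Product measures on sequence spaces -/

/-- The set of sequences that agree with `x` on the first `n` coordinates. -/
def seqCyl {κ : ℕ → ℕ} (x : ∀ n, Fin (κ n)) (n : ℕ) : Set (∀ n, Fin (κ n)) :=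
  {y | ∀ i, i < n → y i = x i}

/-- The diameter `∏_{i<n} κ_i⁻¹` of a cylinder of generation `n`. -/
def seqDiam (κ : ℕ → ℕ) (n : ℕ) : ℝ := ∏ i ∈ Finset.range n, (κ i : ℝ)⁻¹

/-- `∑_{i<n} (ϑ_i - t) log κ_i`. -/
def expoSum (κ : ℕ → ℕ) (ϑ : ℕ → ℝ) (t : ℝ) (n : ℕ) : ℝ :=
  ∑ i ∈ Finset.range n, (ϑ i - t) * Real.log (κ i)

/-- `μ` is the product measure with positive weights `p` on `∏ Fin (κ n)`, whose metric is the
ultrametric giving diameter `∏_{i<n} κ_i⁻¹` to the cylinders of generation `n`; the alphabets have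
at most `K` letters. -/
structure IsMoranMeasure {κ : ℕ → ℕ} [MetricSpace (∀ n, Fin (κ n))] (K : ℕ)
    (p : ∀ n, Fin (κ n) → ℝ) (μ : Measure (∀ n, Fin (κ n))) : Prop where
  two_le : ∀ n, 2 ≤ κ n
  le_bound : ∀ n, κ n ≤ K
  pos : ∀ n i, 0 < p n i
  dist_eq : ∀ (x y : ∀ n, Fin (κ n)) (n : ℕ), (∀ i, i < n → x i = y i) → x n ≠ y n →
    dist x y = seqDiam κ n
  measure_cyl : ∀ x n, μ (seqCyl x n) = ENNReal.ofReal (∏ i ∈ Finset.range n, p i (x i))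

theorem mem_seqCyl_self {κ : ℕ → ℕ} (x : ∀ n, Fin (κ n)) (n : ℕ) : x ∈ seqCyl x n :=
  fun _ _ => rfl

theorem seqCyl_eq_pi {κ : ℕ → ℕ} (x : ∀ n, Fin (κ n)) (n : ℕ) :
    seqCyl x n = ((Finset.range n : Finset ℕ) : Set ℕ).pi fun i => {x i} := by
  ext y; simp [seqCyl, Set.mem_pi]

theorem measurableSet_seqCyl {κ : ℕ → ℕ} (x : ∀ n, Fin (κ n)) (n : ℕ) :
    MeasurableSet (seqCyl x n) := by
  rw [seqCyl_eq_pi]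
  exact MeasurableSet.pi (Finset.countable_toSet _) fun _ _ => measurableSet_singleton _

theorem exists_seqCyl_cover {κ : ℕ → ℕ} (E : Set (∀ n, Fin (κ n))) (n : ℕ) :
    ∃ (ι : Type) (_ : Countable ι) (c : ι → ∀ n, Fin (κ n)), (∀ i, c i ∈ E) ∧
      (∀ i j, i ≠ j → Disjoint (seqCyl (c i) n) (seqCyl (c j) n)) ∧
      E ⊆ ⋃ i, seqCyl (c i) n := by
  let R : (∀ n, Fin (κ n)) → ∀ i : Fin n, Fin (κ i) := fun x i => x i
  have hR : ∀ w : R '' E, ∃ x ∈ E, R x = w := fun w => w.2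
  choose c hc hcR using hR
  refine ⟨R '' E, inferInstance, c, hc, ?_, ?_⟩
  · intro i j hij
    refine Set.disjoint_left.2 fun y hyi hyj => hij ?_
    apply Subtype.ext
    rw [← hcR i, ← hcR j]
    funext k
    exact (hyi k k.2).symm.trans (hyj k k.2)
  · intro x hx
    refine mem_iUnion.2 ⟨⟨R x, x, hx, rfl⟩, fun i hi => ?_⟩
    exact (congrFun (hcR ⟨R x, x, hx, rfl⟩) ⟨i, hi⟩).symm

theorem exists_productMeasure {κ : ℕ → ℕ} (f : ∀ n, Fin (κ n) → ℝ) (hf : ∀ n i, 0 ≤ f n i)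
    (hsum : ∀ n, ∑ i, f n i = 1) :
    ∃ ν : Measure (∀ n, Fin (κ n)), IsProbabilityMeasure ν ∧
      ∀ x n, ν (seqCyl x n) = ENNReal.ofReal (∏ i ∈ Finset.range n, f i (x i)) := by
  have h1 : ∀ n, ∑ i, ENNReal.ofReal (f n i) = 1 := fun n => by
    rw [← ENNReal.ofReal_sum_of_nonneg fun i _ => hf n i, hsum, ENNReal.ofReal_one]
  refine ⟨Measure.infinitePi fun n => (PMF.ofFintype _ (h1 n)).toMeasure, inferInstance,
    fun x n => ?_⟩
  rw [seqCyl_eq_pi, Measure.infinitePi_pi _ fun _ _ => measurableSet_singleton _,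
    ENNReal.ofReal_prod_of_nonneg fun i _ => hf i _]
  refine Finset.prod_congr rfl fun i _ => ?_
  rw [PMF.toMeasure_apply_singleton _ _ (measurableSet_singleton _), PMF.ofFintype_apply]

theorem seqDiam_pos {κ : ℕ → ℕ} (h2 : ∀ n, 2 ≤ κ n) (n : ℕ) : 0 < seqDiam κ n :=
  Finset.prod_pos fun i _ => inv_pos.2 (Nat.cast_pos.2 (by have := h2 i; omega))

theorem seqDiam_succ_mul {κ : ℕ → ℕ} (h2 : ∀ n, 2 ≤ κ n) (n : ℕ) :
    seqDiam κ (n + 1) * κ n = seqDiam κ n := by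
  have : (κ n : ℝ) ≠ 0 := Nat.cast_ne_zero.2 (by have := h2 n; omega)
  rw [seqDiam, Finset.prod_range_succ, inv_mul_cancel_right₀ this, seqDiam]

theorem seqDiam_strictAnti {κ : ℕ → ℕ} (h2 : ∀ n, 2 ≤ κ n) : StrictAnti (seqDiam κ) := by
  refine strictAnti_nat_of_succ_lt fun n => ?_
  rw [← seqDiam_succ_mul h2 n]
  have : (2 : ℝ) ≤ κ n := by exact_mod_cast h2 n
  nlinarith [seqDiam_pos h2 (n + 1)]

theorem exists_seqDiam_lt {κ : ℕ → ℕ} (h2 : ∀ n, 2 ≤ κ n) {r : ℝ} (hr : 0 < r) :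
    ∃ n, seqDiam κ n < r := by
  obtain ⟨n, hn⟩ := exists_pow_lt_of_lt_one hr (by norm_num : (2⁻¹ : ℝ) < 1)
  refine ⟨n, lt_of_le_of_lt ?_ hn⟩
  rw [← Finset.card_range n, ← Finset.prod_const, Finset.card_range]
  refine Finset.prod_le_prod (fun i _ => by positivity) fun i _ => ?_
  exact inv_anti₀ (by norm_num) (by exact_mod_cast h2 i)

theorem rpow_comparison {d r A : ℝ} (hd : 0 < d) (hdr : d ≤ r) (hrA : 2 * r ≤ A * d) (t : ℝ) :
    (2 * r) ^ t ≤ A ^ |t| * d ^ t ∧ d ^ t ≤ A ^ |t| * (2 * r) ^ t := by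
  have hA : 1 ≤ A := by nlinarith
  rcases le_total 0 t with ht | ht
  · rw [abs_of_nonneg ht]
    constructor
    · rw [← Real.mul_rpow (by linarith) hd.le]
      exact Real.rpow_le_rpow (by linarith) hrA ht
    · calc d ^ t ≤ 1 * (2 * r) ^ t := by
            rw [one_mul]; exact Real.rpow_le_rpow hd.le (by linarith) ht
        _ ≤ _ := mul_le_mul_of_nonneg_right (Real.one_le_rpow hA ht)
            (Real.rpow_nonneg (by linarith) _)
  · rw [abs_of_nonpos ht]
    have hA0 : (0 : ℝ) < A := by linarith
    constructor
    · calc (2 * r) ^ t ≤ 1 * d ^ t := by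
            rw [one_mul]; exact Real.rpow_le_rpow_of_nonpos hd (by linarith) ht
        _ ≤ _ := by
            gcongr
            exact Real.one_le_rpow hA (by linarith)
    · have := Real.rpow_le_rpow_of_nonpos (by linarith) hrA ht
      rw [Real.mul_rpow hA0.le hd.le] at this
      rw [Real.rpow_neg hA0.le]
      rwa [le_inv_mul_iff₀ (Real.rpow_pos_of_pos hA0 t)]

namespace IsMoranMeasure

variable {κ : ℕ → ℕ} [MetricSpace (∀ n, Fin (κ n))] {K : ℕ} {p : ∀ n, Fin (κ n) → ℝ}
  {μ : Measure (∀ n, Fin (κ n))}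

theorem closedBall_eq (h : IsMoranMeasure K p μ) {r : ℝ} {n : ℕ} (hn : seqDiam κ n ≤ r)
    (hlt : ∀ m, m < n → r < seqDiam κ m) (x : ∀ n, Fin (κ n)) :
    closedBall x r = seqCyl x n := by
  ext y
  rw [mem_closedBall]
  by_cases hyx : y = x
  · subst hyx
    simp [mem_seqCyl_self, (seqDiam_pos h.two_le n).le.trans hn]
  · have hex : ∃ k, y k ≠ x k := Function.ne_iff.1 hyx
    have hmin : ∀ i, i < Nat.find hex → y i = x i := fun i hi => not_not.1 (Nat.find_min hex hi)
    rw [h.dist_eq y x _ hmin (Nat.find_spec hex)]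
    constructor
    · intro hk i hi
      refine hmin i (hi.trans_le ?_)
      by_contra! hcon
      exact absurd hk (not_le.2 (hlt _ hcon))
    · intro hy
      have : n ≤ Nat.find hex := by
        by_contra! hcon
        exact Nat.find_spec hex (hy _ hcon)
      exact ((seqDiam_strictAnti h.two_le).antitone this).trans hn

theorem closedBall_seqDiam (h : IsMoranMeasure K p μ) (x : ∀ n, Fin (κ n)) (n : ℕ) :
    closedBall x (seqDiam κ n) = seqCyl x n :=
  h.closedBall_eq le_rfl (fun _ hm => seqDiam_strictAnti h.two_le hm) x

theorem exists_closedBall_eq (h : IsMoranMeasure K p μ) {r : ℝ} (hr : 0 < r) {n₀ : ℕ}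
    (hn₀ : 0 < n₀) (hr₀ : r ≤ seqDiam κ n₀) :
    ∃ n, n₀ ≤ n ∧ (∀ x : ∀ n, Fin (κ n), closedBall x r = seqCyl x n) ∧
      seqDiam κ n ≤ r ∧ r ≤ K * seqDiam κ n := by
  have hex : ∃ n, seqDiam κ n ≤ r := (exists_seqDiam_lt h.two_le hr).imp fun _ => le_of_lt
  have hlt : ∀ m, m < Nat.find hex → r < seqDiam κ m := fun m hm => not_le.1 (Nat.find_min hex hm)
  have hge : n₀ ≤ Nat.find hex := by
    by_contra! hcon
    exact absurd (Nat.find_spec hex)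
      (not_le.2 (hr₀.trans_lt (seqDiam_strictAnti h.two_le hcon)))
  refine ⟨Nat.find hex, hge, h.closedBall_eq (Nat.find_spec hex) hlt, Nat.find_spec hex, ?_⟩
  obtain ⟨m, hm⟩ : ∃ m, Nat.find hex = m + 1 := Nat.exists_eq_succ_of_ne_zero (by omega)
  have h1 := hlt m (by omega)
  rw [← seqDiam_succ_mul h.two_le m, ← hm] at h1
  have h2 : (κ m : ℝ) ≤ K := by exact_mod_cast h.le_bound m
  nlinarith [seqDiam_pos h.two_le (Nat.find hex)]

theorem msupport_eq (h : IsMoranMeasure K p μ) : msupport μ = univ := by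
  refine eq_univ_of_forall fun x r hr => ?_
  obtain ⟨n, hn⟩ := exists_seqDiam_lt h.two_le hr
  refine lt_of_lt_of_le ?_ (measure_mono (closedBall_subset_ball (x := x) hn))
  rw [h.closedBall_seqDiam, h.measure_cyl, ENNReal.ofReal_pos]
  exact Finset.prod_pos fun i _ => h.pos i _

/-- The measure `ν` with weights `p_i^q κ_i^{-ϑ_i}`, for which
`μ(C)^q |C|^t = ν(C) exp (∑_{i<n} (ϑ_i - t) log κ_i)` on the cylinders `C` of generation `n`. -/
theorem exists_tilted (h : IsMoranMeasure K p μ) (q : ℝ) {ϑ : ℕ → ℝ}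
    (hϑ : ∀ n, ∑ i, p n i ^ q = (κ n : ℝ) ^ ϑ n) :
    ∃ ν : Measure (∀ n, Fin (κ n)), IsProbabilityMeasure ν ∧ ∀ x n t,
      μ (seqCyl x n) ^ q * ENNReal.ofReal (seqDiam κ n ^ t) =
        ν (seqCyl x n) * ENNReal.ofReal (Real.exp (expoSum κ ϑ t n)) := by
  have hκ : ∀ n, (0 : ℝ) < κ n := fun n => Nat.cast_pos.2 (by have := h.two_le n; omega)
  have hf : ∀ n i, 0 ≤ p n i ^ q * (κ n : ℝ) ^ (-ϑ n) := fun n i =>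
    mul_nonneg (Real.rpow_nonneg (h.pos n i).le _) (Real.rpow_nonneg (hκ n).le _)
  obtain ⟨ν, hν, hνc⟩ := exists_productMeasure (fun n i => p n i ^ q * (κ n : ℝ) ^ (-ϑ n)) hf
    (fun n => by rw [← Finset.sum_mul, hϑ, ← Real.rpow_add (hκ n), add_neg_cancel,
      Real.rpow_zero])
  refine ⟨ν, hν, fun x n t => ?_⟩
  rw [hνc, h.measure_cyl, ENNReal.ofReal_rpow_of_pos (Finset.prod_pos fun i _ => h.pos i _),
    ← ENNReal.ofReal_mul (Real.rpow_nonneg (Finset.prod_nonneg fun i _ => (h.pos i _).le) _),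
    ← ENNReal.ofReal_mul (Finset.prod_nonneg fun i _ => hf i _)]
  congr 1
  rw [expoSum, Real.exp_sum, seqDiam, ← Real.finsetProd_rpow _ _ fun i _ => (h.pos i _).le,
    ← Real.finsetProd_rpow _ _ fun i _ => (inv_pos.2 (hκ i)).le, ← Finset.prod_mul_distrib,
    ← Finset.prod_mul_distrib]
  refine Finset.prod_congr rfl fun i _ => ?_
  rw [mul_comm (ϑ i - t), ← Real.rpow_def_of_pos (hκ i), mul_assoc, ← Real.rpow_add (hκ i),
    Real.inv_rpow (hκ i).le, ← Real.rpow_neg (hκ i).le]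
  congr 2
  ring

theorem term_comparison (h : IsMoranMeasure K p μ) {q : ℝ} {ϑ : ℕ → ℝ}
    {ν : Measure (∀ n, Fin (κ n))} (hν : ∀ x n t,
      μ (seqCyl x n) ^ q * ENNReal.ofReal (seqDiam κ n ^ t) =
        ν (seqCyl x n) * ENNReal.ofReal (Real.exp (expoSum κ ϑ t n)))
    (t : ℝ) {x : ∀ n, Fin (κ n)} {r : ℝ} {n : ℕ} (hx : closedBall x r = seqCyl x n)
    (hn : seqDiam κ n ≤ r) (hr : r ≤ K * seqDiam κ n) :
    μ (closedBall x r) ^ q * ENNReal.ofReal (2 * r) ^ t ≤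
        ENNReal.ofReal ((2 * K) ^ |t|) *
          (ν (closedBall x r) * ENNReal.ofReal (Real.exp (expoSum κ ϑ t n))) ∧
      ν (closedBall x r) * ENNReal.ofReal (Real.exp (expoSum κ ϑ t n)) ≤
        ENNReal.ofReal ((2 * K) ^ |t|) *
          (μ (closedBall x r) ^ q * ENNReal.ofReal (2 * r) ^ t) := by
  have hd := seqDiam_pos h.two_le n
  have hA : (0 : ℝ) ≤ (2 * K) ^ |t| := by positivity
  obtain ⟨h1, h2⟩ := rpow_comparison hd hn (A := 2 * K) (by linarith) t
  rw [hx, ← hν, ENNReal.ofReal_rpow_of_pos (by linarith), mul_left_comm, mul_left_comm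
    (ENNReal.ofReal ((2 * K) ^ |t|)), ← ENNReal.ofReal_mul hA, ← ENNReal.ofReal_mul hA]
  constructor <;> gcongr

theorem ofReal_bound_ne_zero (h : IsMoranMeasure K p μ) (t : ℝ) :
    ENNReal.ofReal ((2 * K) ^ |t|) ≠ 0 := by
  have hK : (2 : ℝ) ≤ K := by exact_mod_cast (h.two_le 0).trans (h.le_bound 0)
  rw [Ne, ENNReal.ofReal_eq_zero, not_le]
  positivity

theorem Ppre_eq_zero (h : IsMoranMeasure K p μ) {q : ℝ} {ϑ : ℕ → ℝ}
    (hϑ : ∀ n, ∑ i, p n i ^ q = (κ n : ℝ) ^ ϑ n) {t : ℝ}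
    (ht : Tendsto (expoSum κ ϑ t) atTop atBot) (E : Set (∀ n, Fin (κ n))) :
    Ppre μ q t E = 0 := by
  obtain ⟨ν, hν1, hν⟩ := h.exists_tilted q hϑ
  have hlim : Tendsto (fun n => ENNReal.ofReal ((2 * K) ^ |t|) *
      ENNReal.ofReal (Real.exp (expoSum κ ϑ t n))) atTop (𝓝 0) := by
    have := ENNReal.Tendsto.const_mul (a := ENNReal.ofReal ((2 * K) ^ |t|))
      (ENNReal.tendsto_ofReal (Real.tendsto_exp_atBot.comp ht)) (Or.inr ENNReal.ofReal_ne_top)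
    simpa using this
  refine le_antisymm (le_of_forall_gt_imp_ge_of_dense fun ε hε => ?_) zero_le
  obtain ⟨N, hN⟩ := eventually_atTop.1 (hlim.eventually (gt_mem_nhds hε))
  refine iInf₂_le_of_le (seqDiam κ (N + 1)) (seqDiam_pos h.two_le _) ?_
  refine iSup_le fun ι => iSup_le fun hι => iSup_le fun c => iSup_le fun r => iSup_le fun _ =>
    iSup_le fun hr => iSup_le fun hdisj => ?_
  choose n hnN hball hn hnK using fun i =>
    h.exists_closedBall_eq (hr i).1 (Nat.succ_pos N) (hr i).2
  calc olsenSum μ q t c r ≤ ∑' i, ε * ν (closedBall (c i) (r i)) := by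
        refine ENNReal.tsum_le_tsum fun i => ?_
        refine (h.term_comparison hν t (hball i (c i)) (hn i) (hnK i)).1.trans ?_
        rw [mul_left_comm, mul_comm ε]
        gcongr
        exact (hN _ (by have := hnN i; omega)).le
    _ = ε * ∑' i, ν (closedBall (c i) (r i)) := ENNReal.tsum_mul_left
    _ ≤ ε * ν (⋃ i, closedBall (c i) (r i)) := by
        gcongr
        refine tsum_meas_le_meas_iUnion_of_disjoint ν (fun i => ?_) hdisj
        rw [hball]
        exact measurableSet_seqCyl _ _
    _ ≤ ε * 1 := by gcongr; exact prob_le_one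
    _ = ε := mul_one ε

theorem le_mul_Ppre (h : IsMoranMeasure K p μ) {q : ℝ} {ϑ : ℕ → ℝ}
    {ν : Measure (∀ n, Fin (κ n))} (hν : ∀ x n t,
      μ (seqCyl x n) ^ q * ENNReal.ofReal (seqDiam κ n ^ t) =
        ν (seqCyl x n) * ENNReal.ofReal (Real.exp (expoSum κ ϑ t n))) {t : ℝ}
    (ht : ∃ᶠ n in atTop, 0 ≤ expoSum κ ϑ t n) (E : Set (∀ n, Fin (κ n))) :
    ν E ≤ ENNReal.ofReal ((2 * K) ^ |t|) * Ppre μ q t E := by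
  have hK : (2 : ℝ) ≤ K := by exact_mod_cast (h.two_le 0).trans (h.le_bound 0)
  have hA0 := h.ofReal_bound_ne_zero t
  rw [mul_comm, ← ENNReal.div_le_iff_le_mul (Or.inl hA0) (Or.inl ENNReal.ofReal_ne_top)]
  refine le_iInf₂ fun δ hδ => ?_
  obtain ⟨N, hN⟩ := exists_seqDiam_lt h.two_le hδ
  obtain ⟨n, hNn, hn⟩ := frequently_atTop.1 ht N
  obtain ⟨ι, hι, c, hcE, hdisj, hcov⟩ := exists_seqCyl_cover E n
  simp only [← h.closedBall_seqDiam] at hdisj hcov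
  have hd := seqDiam_pos h.two_le n
  refine le_iSup_of_le ι <| le_iSup_of_le hι <| le_iSup_of_le c <|
    le_iSup_of_le (fun _ => seqDiam κ n) <| le_iSup_of_le hcE <|
    le_iSup_of_le (fun _ => ⟨hd, ?_⟩) <| le_iSup_of_le hdisj ?_
  · exact ((seqDiam_strictAnti h.two_le).antitone hNn).trans hN.le
  rw [ENNReal.div_le_iff_le_mul (Or.inl hA0) (Or.inl ENNReal.ofReal_ne_top), mul_comm]
  calc ν E ≤ ∑' i, ν (closedBall (c i) (seqDiam κ n)) :=
        (measure_mono hcov).trans (measure_iUnion_le _)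
    _ ≤ ∑' i, ENNReal.ofReal ((2 * K) ^ |t|) *
          (μ (closedBall (c i) (seqDiam κ n)) ^ q * ENNReal.ofReal (2 * seqDiam κ n) ^ t) := by
        refine ENNReal.tsum_le_tsum fun i => ?_
        refine le_trans (le_mul_of_one_le_right' ?_) (h.term_comparison hν t
          (h.closedBall_seqDiam (c i) n) le_rfl (by nlinarith)).2
        rw [ENNReal.one_le_ofReal]
        exact Real.one_le_exp hn
    _ = _ := ENNReal.tsum_mul_left

theorem Ppre_ne_zero (h : IsMoranMeasure K p μ) {q : ℝ} {ϑ : ℕ → ℝ}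
    (hϑ : ∀ n, ∑ i, p n i ^ q = (κ n : ℝ) ^ ϑ n) {t : ℝ}
    (ht : ∃ᶠ n in atTop, 0 ≤ expoSum κ ϑ t n) : Ppre μ q t univ ≠ 0 := by
  obtain ⟨ν, hν1, hν⟩ := h.exists_tilted q hϑ
  intro h0
  have := h.le_mul_Ppre hν ht univ
  rw [h0, measure_univ, mul_zero] at this
  exact absurd this (by simp)

theorem Pmeas_ne_zero (h : IsMoranMeasure K p μ) {q : ℝ} {ϑ : ℕ → ℝ}
    (hϑ : ∀ n, ∑ i, p n i ^ q = (κ n : ℝ) ^ ϑ n) {t : ℝ}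
    (ht : ∃ᶠ n in atTop, 0 ≤ expoSum κ ϑ t n) : Pmeas μ q t univ ≠ 0 := by
  obtain ⟨ν, hν1, hν⟩ := h.exists_tilted q hϑ
  have hle : (ENNReal.ofReal ((2 * K) ^ |t|))⁻¹ ≤ Pmeas μ q t univ := by
    refine le_iInf₂ fun En hEn => ?_
    rw [ENNReal.inv_le_iff_le_mul (fun _ => h.ofReal_bound_ne_zero t) (by simp), ← ENNReal.tsum_mul_left]
    calc (1 : ℝ≥0∞) = ν univ := measure_univ.symm
      _ ≤ ∑' n, ν (En n) := (measure_mono hEn).trans (measure_iUnion_le _)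
      _ ≤ _ := ENNReal.tsum_le_tsum fun n => h.le_mul_Ppre hν ht (En n)
  exact ((ENNReal.inv_pos.2 ENNReal.ofReal_ne_top).trans_le hle).ne'

theorem Hmeas_eq_zero (h : IsMoranMeasure K p μ) {q : ℝ} {ϑ : ℕ → ℝ}
    (hϑ : ∀ n, ∑ i, p n i ^ q = (κ n : ℝ) ^ ϑ n) {t : ℝ}
    (ht : ∀ C : ℝ, ∃ᶠ n in atTop, expoSum κ ϑ t n ≤ C) (E : Set (∀ n, Fin (κ n))) :
    Hmeas μ q t E = 0 := by
  obtain ⟨ν, hν1, hν⟩ := h.exists_tilted q hϑ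
  have hK : (2 : ℝ) ≤ K := by exact_mod_cast (h.two_le 0).trans (h.le_bound 0)
  refine le_antisymm (iSup₂_le fun F _ => iSup₂_le fun δ hδ =>
    le_of_forall_gt_imp_ge_of_dense fun ε hε => ?_) zero_le
  have hlim : Tendsto (fun C => ENNReal.ofReal ((2 * K) ^ |t|) *
      ENNReal.ofReal (Real.exp C)) atBot (𝓝 0) := by
    have := ENNReal.Tendsto.const_mul (a := ENNReal.ofReal ((2 * K) ^ |t|))
      (ENNReal.tendsto_ofReal Real.tendsto_exp_atBot) (Or.inr ENNReal.ofReal_ne_top)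
    simpa using this
  obtain ⟨C, hC⟩ := (hlim.eventually (gt_mem_nhds hε)).exists
  obtain ⟨N, hN⟩ := exists_seqDiam_lt h.two_le hδ
  obtain ⟨n, hNn, hn⟩ := frequently_atTop.1 (ht C) N
  obtain ⟨ι, hι, c, hcF, hdisj, hcov⟩ := exists_seqCyl_cover F n
  have hmeas : ∀ i, MeasurableSet (closedBall (c i) (seqDiam κ n)) := fun i => by
    rw [h.closedBall_seqDiam]; exact measurableSet_seqCyl _ _
  simp only [← h.closedBall_seqDiam] at hdisj hcov
  have hd := seqDiam_pos h.two_le n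
  refine iInf_le_of_le ι <| iInf_le_of_le hι <| iInf_le_of_le c <|
    iInf_le_of_le (fun _ => seqDiam κ n) <| iInf_le_of_le hcF <|
    iInf_le_of_le (fun _ => ⟨hd, ?_⟩) <| iInf_le_of_le hcov ?_
  · exact ((seqDiam_strictAnti h.two_le).antitone hNn).trans hN.le
  calc olsenSum μ q t c (fun _ => seqDiam κ n)
      ≤ ∑' i, ε * ν (closedBall (c i) (seqDiam κ n)) := by
        refine ENNReal.tsum_le_tsum fun i => ?_
        refine (h.term_comparison hν t (h.closedBall_seqDiam (c i) n) le_rfl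
          (by nlinarith)).1.trans ?_
        rw [mul_left_comm, mul_comm ε]
        gcongr
        refine le_trans ?_ hC.le
        gcongr
    _ = ε * ∑' i, ν (closedBall (c i) (seqDiam κ n)) := ENNReal.tsum_mul_left
    _ ≤ ε * ν (⋃ i, closedBall (c i) (seqDiam κ n)) := by
        gcongr
        exact tsum_meas_le_meas_iUnion_of_disjoint ν hmeas hdisj
    _ ≤ ε * 1 := by gcongr; exact prob_le_one
    _ = ε := mul_one ε

theorem Hmeas_ne_zero (h : IsMoranMeasure K p μ) {q : ℝ} {ϑ : ℕ → ℝ}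
    (hϑ : ∀ n, ∑ i, p n i ^ q = (κ n : ℝ) ^ ϑ n) {t : ℝ}
    (ht : ∀ n, 0 ≤ expoSum κ ϑ t n) : Hmeas μ q t univ ≠ 0 := by
  obtain ⟨ν, hν1, hν⟩ := h.exists_tilted q hϑ
  have hle : (ENNReal.ofReal ((2 * K) ^ |t|))⁻¹ ≤ Hmeas μ q t univ := by
    refine le_iSup₂_of_le univ Subset.rfl <|
      le_iSup₂_of_le (seqDiam κ 1) (seqDiam_pos h.two_le 1) ?_
    refine le_iInf fun ι => le_iInf fun hι => le_iInf fun c => le_iInf fun r => le_iInf fun _ =>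
      le_iInf fun hr => le_iInf fun hcov => ?_
    choose n _ hball hn hnK using fun i =>
      h.exists_closedBall_eq (hr i).1 Nat.one_pos (hr i).2
    rw [ENNReal.inv_le_iff_le_mul (fun _ => h.ofReal_bound_ne_zero t) (by simp), olsenSum, ← ENNReal.tsum_mul_left]
    calc (1 : ℝ≥0∞) = ν univ := measure_univ.symm
      _ ≤ ∑' i, ν (closedBall (c i) (r i)) := (measure_mono hcov).trans (measure_iUnion_le _)
      _ ≤ _ := by
        refine ENNReal.tsum_le_tsum fun i => ?_
        refine le_trans (le_mul_of_one_le_right' ?_) (h.term_comparison hν t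
          (hball i (c i)) (hn i) (hnK i)).2
        rw [ENNReal.one_le_ofReal]
        exact Real.one_le_exp (ht _)
  exact ((ENNReal.inv_pos.2 ENNReal.ofReal_ne_top).trans_le hle).ne'

end IsMoranMeasure

theorem Pmeas_eq_zero_of_Ppre {Y : Type} [MetricSpace Y] [MeasurableSpace Y] {m : Measure Y}
    {q t : ℝ} (h : ∀ E : Set Y, Ppre m q t E = 0) (E : Set Y) : Pmeas m q t E = 0 :=
  le_antisymm (iInf₂_le_of_le (fun _ => E) (subset_iUnion (fun _ : ℕ => E) 0) (by simp [h]))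
    zero_le

theorem sInf_eq_of_threshold {S : Set ℝ} {M : ℝ} (hgt : ∀ t, M < t → t ∈ S)
    (hlt : ∀ t, t < M → t ∉ S) : sInf S = M :=
  csInf_eq_of_forall_ge_of_forall_gt_exists_lt ⟨M + 1, hgt _ (lt_add_one M)⟩
    (fun t ht => not_lt.1 fun h => hlt t h ht)
    fun w hw => ⟨(M + w) / 2, hgt _ (by linarith), by linarith⟩

/-! ### Sums along rapidly growing blocks -/

theorem le_of_strictMono_from_one {T : ℕ → ℕ} (hT1 : T 1 = 1)
    (hT : ∀ k, 1 ≤ k → T k < T (k + 1)) {k : ℕ} (hk : 1 ≤ k) : k ≤ T k := by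
  induction k, hk using Nat.le_induction with
  | base => exact hT1.ge
  | succ k hk ih => exact ih.trans_lt (hT k hk)

theorem monotone_from_one {T : ℕ → ℕ} (hT : ∀ k, 1 ≤ k → T k < T (k + 1)) {k l : ℕ}
    (hk : 1 ≤ k) (hkl : k ≤ l) : T k ≤ T l := by
  induction l, hkl using Nat.le_induction with
  | base => exact le_rfl
  | succ l hl ih => exact ih.trans (hT l (hk.trans hl)).le

theorem frequently_le_sum_of_blocks {T : ℕ → ℕ} (hT1 : T 1 = 1)
    (hT : ∀ k, 1 ≤ k → T k < T (k + 1))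
    (hTrat : Tendsto (fun k => (T (k + 1) : ℝ) / (T k : ℝ)) atTop atTop)
    {g : ℕ → ℝ} {B α : ℝ} (hα : 0 < α) (hg : ∀ i, -B ≤ g i) {f : ℕ → ℕ}
    (hf : Tendsto f atTop atTop)
    (hblock : ∀ k i, T (f k) ≤ i + 1 → i + 1 < T (f k + 1) → α ≤ g i) (C : ℝ) :
    ∃ᶠ n in atTop, C ≤ ∑ i ∈ Finset.range n, g i := by
  refine frequently_atTop.2 fun N => ?_
  have hB : ∀ i, -|B| ≤ g i := fun i => (neg_le_neg (le_abs_self B)).trans (hg i)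
  obtain ⟨k, hk1, hkN, hkr⟩ := ((hf.eventually_ge_atTop 1).and ((hf.eventually_ge_atTop N).and
    ((hTrat.comp hf).eventually_ge_atTop ((|B| + α + (|C| + α)) / α)))).exists
  have hTk := le_of_strictMono_from_one hT1 hT hk1
  have hTk' := hT _ hk1
  obtain ⟨n, hn⟩ : ∃ n, T (f k + 1) = n + 1 := Nat.exists_eq_succ_of_ne_zero (by omega)
  refine ⟨n, by omega, ?_⟩
  have hpt : ∀ i ∈ Finset.range n,
      α - (if i < T (f k) then |B| + α else 0) ≤ g i := by
    intro i hi
    rw [Finset.mem_range] at hi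
    split_ifs with h
    · linarith [hB i]
    · rw [sub_zero]
      exact hblock k i (by omega) (by omega)
  have hcard : ∑ i ∈ Finset.range n, (if i < T (f k) then |B| + α else 0) ≤
      T (f k) * (|B| + α) := by
    rw [← Finset.sum_filter, Finset.sum_const, nsmul_eq_mul]
    have : ((Finset.range n).filter (· < T (f k))).card ≤ T (f k) := by
      calc _ ≤ (Finset.range (T (f k))).card := Finset.card_le_card fun i hi => by
              simpa using (Finset.mem_filter.1 hi).2
        _ = _ := Finset.card_range _
    have h0 := abs_nonneg B
    gcongr
  have hsum := Finset.sum_le_sum hpt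
  rw [Finset.sum_sub_distrib, Finset.sum_const, Finset.card_range, nsmul_eq_mul] at hsum
  have hT1' : (1 : ℝ) ≤ T (f k) := by exact_mod_cast hk1.trans hTk
  have hratio : T (f k) * (|B| + α + (|C| + α)) ≤ ((n : ℝ) + 1) * α := by
    have h1 : (|B| + α + (|C| + α)) / α ≤ (T (f k + 1) : ℝ) / T (f k) := hkr
    rw [div_le_div_iff₀ hα (by linarith), hn] at h1
    push_cast at h1
    linarith
  have h2 : |C| + α ≤ T (f k) * (|C| + α) :=
    le_mul_of_one_le_left (by positivity) hT1'
  linarith [le_abs_self C]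

/-! ### The mixed symbolic space -/

theorem not_isA_of_mem_block {T : ℕ → ℕ} (hT : ∀ k, 1 ≤ k → T k < T (k + 1)) {j k : ℕ}
    (hk : 1 ≤ k) (h1 : T (2 * k) ≤ j) (h2 : j < T (2 * k + 1)) : ¬ isA T j := by
  rintro ⟨l, hl, hl1, hl2⟩
  rcases le_or_gt l k with hlk | hlk
  · have := monotone_from_one hT (k := 2 * l) (l := 2 * k) (by omega) (by omega)
    omega
  · have := monotone_from_one hT (k := 2 * k + 1) (l := 2 * l - 1) (by omega) (by omega)
    omega

theorem Ncount_le (T : ℕ → ℕ) (n : ℕ) : Ncount T n ≤ n :=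
  (Finset.card_filter_le _ _).trans (by simp)

theorem Ncount_succ (T : ℕ → ℕ) (n : ℕ) :
    Ncount T (n + 1) = Ncount T n + if isA T (n + 1) then 1 else 0 := by
  rw [Ncount, ← Finset.insert_Icc_right_eq_Icc_add_one (by omega), Finset.filter_insert]
  split_ifs with h
  · rw [Finset.card_insert_of_notMem (by simp), Ncount]
  · rfl

theorem Dw_eq_seqDiam (c₁ c₂ : ℕ) (T : ℕ → ℕ) (n : ℕ) :
    Dw c₁ c₂ T n = seqDiam (Yc c₁ c₂ T) n := by
  induction n with
  | zero => simp [Dw, seqDiam, Ncount]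
  | succ n ih =>
    rw [seqDiam, Finset.prod_range_succ, ← seqDiam, ← ih, Dw, Dw, Ncount_succ, Yc]
    have := Ncount_le T n
    split_ifs with h
    · rw [show n + 1 - (Ncount T n + 1) = n - Ncount T n by omega, pow_succ, ← mul_inv]
      ring_nf
    · rw [add_zero, show n + 1 - Ncount T n = n - Ncount T n + 1 by omega, pow_succ, ← mul_inv]
      ring_nf

theorem rpow_theta {c : ℕ} (hc : 2 ≤ c) {w : ℕ → ℝ} (hw : ∀ i, i < c → 0 < w i) (q : ℝ) :
    (c : ℝ) ^ theta c w q = ∑ i ∈ Finset.range c, w i ^ q := by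
  have hc' : (2 : ℝ) ≤ c := by exact_mod_cast hc
  refine Real.rpow_logb (by linarith) (by linarith) (Finset.sum_pos (fun i hi => ?_) ?_)
  · exact Real.rpow_pos_of_pos (hw i (Finset.mem_range.1 hi)) _
  · exact Finset.nonempty_range_iff.2 (by omega)

/-- The weight of a letter at (0-based) position `n`. -/
def letterWeight (c₁ c₂ : ℕ) (T : ℕ → ℕ) (a b : ℕ → ℝ) (n : ℕ) (i : Fin (Yc c₁ c₂ T n)) : ℝ :=
  if isA T (n + 1) then a i else b i

theorem isMoranMeasure_mixed {c₁ c₂ : ℕ} (hc₁ : 2 ≤ c₁) (hc₂ : 2 ≤ c₂) {T : ℕ → ℕ} {a b : ℕ → ℝ}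
    (ha : ∀ i, i < c₁ → 0 < a i) (hb : ∀ j, j < c₂ → 0 < b j) [MetricSpace (Omg c₁ c₂ T)]
    (hdist : ∀ (x y : Omg c₁ c₂ T) (n : ℕ), (∀ i, i < n → x i = y i) → x n ≠ y n →
      dist x y = Dw c₁ c₂ T n) {μ : Measure (Omg c₁ c₂ T)}
    (hμ : ∀ (n : ℕ) (w : Word c₁ c₂ T n),
      μ (cyl c₁ c₂ T n w) = ENNReal.ofReal (cylWeight c₁ c₂ T a b n w)) :
    IsMoranMeasure (c₁ + c₂) (letterWeight c₁ c₂ T a b) μ where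
  two_le n := by unfold Yc; split_ifs <;> assumption
  le_bound n := by unfold Yc; split_ifs <;> omega
  pos n i := by
    rw [letterWeight]
    split_ifs with h
    · exact ha _ (i.2.trans_eq (if_pos h))
    · exact hb _ (i.2.trans_eq (if_neg h))
  dist_eq x y n h1 h2 := (hdist x y n h1 h2).trans (Dw_eq_seqDiam _ _ _ _)
  measure_cyl x n := by
    have hcyl : seqCyl x n = cyl c₁ c₂ T n fun i => x i := by
      ext y
      exact ⟨fun h i => h i i.2, fun h i hi => h ⟨i, hi⟩⟩
    rw [hcyl, hμ, cylWeight, Finset.prod_range]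
    rfl

theorem sum_letterWeight_rpow {c₁ c₂ : ℕ} (hc₁ : 2 ≤ c₁) (hc₂ : 2 ≤ c₂) {T : ℕ → ℕ} {a b : ℕ → ℝ}
    (ha : ∀ i, i < c₁ → 0 < a i) (hb : ∀ j, j < c₂ → 0 < b j) (q : ℝ) (n : ℕ) :
    ∑ i, letterWeight c₁ c₂ T a b n i ^ q =
      (Yc c₁ c₂ T n : ℝ) ^ (if isA T (n + 1) then theta c₁ a q else theta c₂ b q) := by
  unfold letterWeight
  by_cases h : isA T (n + 1)
  · simp only [h, if_true]
    rw [← Finset.sum_range fun i => a i ^ q, Yc, if_pos h, rpow_theta hc₁ ha]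
  · simp only [h, if_false]
    rw [← Finset.sum_range fun i => b i ^ q, Yc, if_neg h, rpow_theta hc₂ hb]

theorem frequently_le_sum_mixed {T : ℕ → ℕ} (hT1 : T 1 = 1)
    (hT : ∀ k, 1 ≤ k → T k < T (k + 1))
    (hTrat : Tendsto (fun k => (T (k + 1) : ℝ) / (T k : ℝ)) atTop atTop) {u v : ℝ}
    (huv : 0 < u ∨ 0 < v) (C : ℝ) :
    ∃ᶠ n in atTop, C ≤ ∑ i ∈ Finset.range n, if isA T (i + 1) then u else v := by
  have hg : ∀ i : ℕ, -(|u| + |v|) ≤ if isA T (i + 1) then u else v := by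
    intro i
    split_ifs
    · linarith [neg_abs_le u, abs_nonneg v]
    · linarith [neg_abs_le v, abs_nonneg u]
  rcases huv with hu | hv
  · refine frequently_le_sum_of_blocks hT1 hT hTrat hu hg (f := fun k => 2 * k + 1)
      (tendsto_atTop_mono (fun k => by simp only [id]; omega) tendsto_id) (fun k i h1 h2 => ?_) C
    rw [if_pos ⟨k + 1, by omega, h1, h2⟩]
  · refine frequently_le_sum_of_blocks hT1 hT hTrat hv hg (f := fun k => 2 * (k + 1))
      (tendsto_atTop_mono (fun k => by simp only [id]; omega) tendsto_id)
      (fun k i h1 h2 => ?_) C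
    rw [if_neg (not_isA_of_mem_block hT (by omega) h1 h2)]

theorem expoSum_mixed (c₁ c₂ : ℕ) (T : ℕ → ℕ) (θ₁ θ₂ t : ℝ) (n : ℕ) :
    expoSum (Yc c₁ c₂ T) (fun n => if isA T (n + 1) then θ₁ else θ₂) t n =
      ∑ i ∈ Finset.range n, if isA T (i + 1) then (θ₁ - t) * Real.log c₁
        else (θ₂ - t) * Real.log c₂ := by
  refine Finset.sum_congr rfl fun i _ => ?_
  unfold Yc
  dsimp only
  split_ifs <;> rfl

theorem tendsto_sum_mixed_atBot (T : ℕ → ℕ) {u v : ℝ} (hu : u < 0) (hv : v < 0) :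
    Tendsto (fun n => ∑ i ∈ Finset.range n, if isA T (i + 1) then u else v) atTop atBot := by
  refine tendsto_atBot_mono (fun n => ?_)
    (tendsto_natCast_atTop_atTop.atTop_mul_const_of_neg (max_lt hu hv))
  rw [← nsmul_eq_mul, ← Finset.card_range n, ← Finset.sum_const, Finset.card_range]
  refine Finset.sum_le_sum fun i _ => ?_
  split_ifs
  · exact le_max_left _ _
  · exact le_max_right _ _

/-- Theorem 1 of the paper. For the inhomogeeous multinomial measure `μ`
on the mixed symbolic space, `B_μ(q) = τ_μ(q) = max(θ_a(q), θ_b(q))` and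
`b_μ(q) = min(θ_a(q), θ_b(q))`. -/
theorem stmt1 (c₁ c₂ : ℕ) (hc₁ : 2 ≤ c₁) (hc₂ : 2 ≤ c₂)
    (T : ℕ → ℕ) (hT1 : T 1 = 1) (hTmono : ∀ k, 1 ≤ k → T k < T (k + 1))
    (hTrat : Tendsto (fun k => (T (k + 1) : ℝ) / (T k : ℝ)) atTop atTop)
    (a b : ℕ → ℝ) (ha : ∀ i, i < c₁ → 0 < a i ∧ a i < 1)
    (hb : ∀ j, j < c₂ → 0 < b j ∧ b j < 1)
    (hsa : ∑ i ∈ Finset.range c₁, a i = 1) (hsb : ∑ j ∈ Finset.range c₂, b j = 1)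
    [MetricSpace (Omg c₁ c₂ T)]
    (hdist : ∀ (x y : Omg c₁ c₂ T) (n : ℕ), (∀ i, i < n → x i = y i) → x n ≠ y n →
      dist x y = Dw c₁ c₂ T n)
    (μ : Measure (Omg c₁ c₂ T)) [IsProbabilityMeasure μ]
    (hμ : ∀ (n : ℕ) (w : Word c₁ c₂ T n),
      μ (cyl c₁ c₂ T n w) = ENNReal.ofReal (cylWeight c₁ c₂ T a b n w))
    (q : ℝ) :
    BFun μ q = max (theta c₁ a q) (theta c₂ b q) ∧
    tauFun μ q = max (theta c₁ a q) (theta c₂ b q) ∧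
    bFun μ q = min (theta c₁ a q) (theta c₂ b q) := by
  have ha' := fun i hi => (ha i hi).1
  have hb' := fun i hi => (hb i hi).1
  have h := isMoranMeasure_mixed hc₁ hc₂ ha' hb' hdist hμ
  have hϑ := sum_letterWeight_rpow hc₁ hc₂ (T := T) ha' hb' q
  have hl₁ : 0 < Real.log c₁ := Real.log_pos (by exact_mod_cast hc₁)
  have hl₂ : 0 < Real.log c₂ := Real.log_pos (by exact_mod_cast hc₂)
  have hexp := expoSum_mixed c₁ c₂ T (theta c₁ a q) (theta c₂ b q)
  have hpack : ∀ t, max (theta c₁ a q) (theta c₂ b q) < t → ∀ E, Ppre μ q t E = 0 := by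
    intro t ht
    rw [max_lt_iff] at ht
    refine h.Ppre_eq_zero hϑ ?_
    rw [funext (hexp t)]
    exact tendsto_sum_mixed_atBot T (mul_neg_of_neg_of_pos (by linarith) hl₁)
      (mul_neg_of_neg_of_pos (by linarith) hl₂)
  have hfreq : ∀ t, t < max (theta c₁ a q) (theta c₂ b q) → ∃ᶠ n in atTop, 0 ≤
      expoSum (Yc c₁ c₂ T)
        (fun n => if isA T (n + 1) then theta c₁ a q else theta c₂ b q) t n := by
    intro t ht
    simp only [hexp]
    refine frequently_le_sum_mixed hT1 hTmono hTrat ((lt_max_iff.1 ht).imp ?_ ?_) 0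
    · exact fun hlt => mul_pos (by linarith) hl₁
    · exact fun hlt => mul_pos (by linarith) hl₂
  rw [BFun, tauFun, bFun, h.msupport_eq]
  refine ⟨sInf_eq_of_threshold (fun t ht => Pmeas_eq_zero_of_Ppre (hpack t ht) _)
    fun t ht => h.Pmeas_ne_zero hϑ (hfreq t ht), sInf_eq_of_threshold (fun t ht => hpack t ht _)
    fun t ht => h.Ppre_ne_zero hϑ (hfreq t ht), sInf_eq_of_threshold (fun t ht => ?_)
    fun t ht => h.Hmeas_ne_zero hϑ fun n => ?_⟩
  · refine h.Hmeas_eq_zero hϑ (fun C => ?_) _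
    have := frequently_le_sum_mixed hT1 hTmono hTrat
      (u := -((theta c₁ a q - t) * Real.log c₁)) (v := -((theta c₂ b q - t) * Real.log c₂))
      ((min_lt_iff.1 ht).imp (fun hlt => neg_pos.2 (mul_neg_of_neg_of_pos (by linarith) hl₁))
        fun hlt => neg_pos.2 (mul_neg_of_neg_of_pos (by linarith) hl₂)) (-C)
    refine this.mono fun n hn => ?_
    rw [hexp]
    simp only [← neg_ite, Finset.sum_neg_distrib] at hn
    exact neg_le_neg_iff.1 hn
  · rw [hexp]
    rw [lt_min_iff] at ht
    refine Finset.sum_nonneg fun i _ => ?_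
    split_ifs
    · exact mul_nonneg (by linarith) hl₁.le
    · exact mul_nonneg (by linarith) hl₂.le

end MF
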